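/- arXiv:2402.17000 — 5 statements merged into one kernel-verified Lean document; each statement's English description precedes it below -/
import Mathlib

section
/- For every odd n ≥ 1, there exist two n×n Boolean matrices that generate, under Boolean matrix multiplication, a subsemigroup with at least ((n²−1)/4)·2^((n²−1)/4) elements. -/
/-- Boolean multiplication of `n × n` Boolean matrices:
`c i j = 1` iff there is `k` with `a i k = 1` and `b k j = 1`. -/
def bmul {n : ℕ} (a b : Matrix (Fin n) (Fin n) Bool) : Matrix (Fin n) (Fin n) Bool :=
  fun i j => decide (∃ k, a i k = true ∧ b k j = true)

/-- The subsemigroup generated by `G` under the binary operation `op`: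
all products of nonempty finite sequences of elements of `G`. -/
def genSet {M : Type*} (op : M → M → M) (G : Set M) : Set M :=
  {x | ∃ (h : M) (t : List M), h ∈ G ∧ (∀ m ∈ t, m ∈ G) ∧ x = t.foldl op h}

/-- Block matrix `[[P^k₁, X shifted], [0, Q^k₂]]` on the index type `ZMod p ⊕ ZMod q`. -/
def blockEntry {p q : ℕ} (k : ZMod p × ZMod q) (X : Finset (ZMod p × ZMod q)) :
    ZMod p ⊕ ZMod q → ZMod p ⊕ ZMod q → Prop
  | Sum.inl a, Sum.inl b => b = a + k.1
  | Sum.inl a, Sum.inr b => (a, b - k.2) ∈ X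
  | Sum.inr _, Sum.inl _ => False
  | Sum.inr a, Sum.inr b => b = a + k.2

open Classical in
/-- The same block matrix transported to `Fin n`. -/
noncomputable def blockMat {n p q : ℕ} (e : Fin n ≃ ZMod p ⊕ ZMod q) (k : ZMod p × ZMod q)
    (X : Finset (ZMod p × ZMod q)) : Matrix (Fin n) (Fin n) Bool :=
  fun i j => decide (blockEntry k X (e i) (e j))

lemma blockMat_mul {n p q : ℕ} (e : Fin n ≃ ZMod p ⊕ ZMod q) (k l : ZMod p × ZMod q)
    (X Y Z : Finset (ZMod p × ZMod q))
    (h : ∀ x y, blockEntry (k + l) Z x y ↔ ∃ z, blockEntry k X x z ∧ blockEntry l Y z y) :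
    bmul (blockMat e k X) (blockMat e l Y) = blockMat e (k + l) Z := by
  funext i j
  unfold bmul blockMat
  rw [decide_eq_decide, h]
  simp only [decide_eq_true_eq]
  constructor
  · rintro ⟨z, hz⟩
    exact ⟨e z, hz⟩
  · rintro ⟨z, hz⟩
    exact ⟨e.symm z, by simpa using hz⟩

lemma blockMat_mul_one {n p q : ℕ} (e : Fin n ≃ ZMod p ⊕ ZMod q) (k : ZMod p × ZMod q)
    (X : Finset (ZMod p × ZMod q)) :
    bmul (blockMat e k X) (blockMat e 1 ∅) = blockMat e (k + 1) X := by
  apply blockMat_mul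
  rintro (a | a) (b | b) <;> simp [blockEntry, add_assoc]
  constructor
  · intro h
    exact ⟨b - 1, by rwa [sub_sub, add_comm 1], by ring⟩
  · rintro ⟨c, h, rfl⟩
    convert h using 2
    ring

lemma blockMat_mul_two {n p q : ℕ} [DecidableEq (ZMod p × ZMod q)]
    (e : Fin n ≃ ZMod p ⊕ ZMod q) (k : ZMod p × ZMod q)
    (X : Finset (ZMod p × ZMod q)) :
    bmul (blockMat e k X) (blockMat e 0 {0}) = blockMat e k (insert (-k) X) := by
  have := blockMat_mul e k 0 X {0} (insert (-k) X) ?_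
  · simpa using this
  rintro (a | a) (b | b) <;> simp [blockEntry]
  rw [Prod.ext_iff, or_congr_left]
  simp [eq_neg_iff_add_eq_zero, sub_eq_add_neg]

lemma blockMat_inj {n p q : ℕ} (e : Fin n ≃ ZMod p ⊕ ZMod q) :
    Function.Injective
      (fun x : (ZMod p × ZMod q) × Finset (ZMod p × ZMod q) => blockMat e x.1 x.2) := by
  rintro ⟨k, X⟩ ⟨l, Y⟩ h
  have h' : ∀ x y, blockEntry k X x y ↔ blockEntry l Y x y := by
    intro x y
    have := congrFun (congrFun h (e.symm x)) (e.symm y)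
    simpa [blockMat] using this
  have h1 : k = l := by
    ext
    · simpa [blockEntry] using h' (Sum.inl 0) (Sum.inl k.1)
    · simpa [blockEntry] using h' (Sum.inr 0) (Sum.inr k.2)
  subst h1
  congr 1
  ext ⟨a, b⟩
  simpa [blockEntry] using h' (Sum.inl a) (Sum.inr (b + k.2))

lemma genSet_mul {M : Type*} (op : M → M → M) (G : Set M) {x g : M}
    (hx : x ∈ genSet op G) (hg : g ∈ G) : op x g ∈ genSet op G := by
  obtain ⟨h, t, hh, ht, rfl⟩ := hx
  refine ⟨h, t ++ [g], hh, ?_, by simp⟩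
  intro m hm
  rcases List.mem_append.1 hm with hm | hm
  · exact ht m hm
  · simp at hm
    exact hm ▸ hg

lemma exists_nat_cast {p q : ℕ} [NeZero p] [NeZero q] (h : p.Coprime q) (d : ZMod p × ZMod q) :
    ∃ j : ℕ, (j : ZMod p × ZMod q) = d := by
  obtain ⟨j, h1, h2⟩ := Nat.chineseRemainder h d.1.val d.2.val
  refine ⟨j, ?_⟩
  ext
  · have := (ZMod.natCast_eq_natCast_iff _ _ _).2 h1
    simpa using this
  · have := (ZMod.natCast_eq_natCast_iff _ _ _).2 h2
    simpa using this

lemma blockMat_mem {n p q : ℕ} [NeZero p] [NeZero q] (h : p.Coprime q)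
    (e : Fin n ≃ ZMod p ⊕ ZMod q) (X : Finset (ZMod p × ZMod q)) :
    ∀ k, blockMat e k X ∈ genSet bmul {blockMat e 1 ∅, blockMat e 0 {0}} := by
  classical
  have key : ∀ (X : Finset (ZMod p × ZMod q)) (k : ZMod p × ZMod q),
      blockMat e k X ∈ genSet bmul {blockMat e 1 ∅, blockMat e 0 {0}} →
      ∀ l, blockMat e l X ∈ genSet bmul {blockMat e 1 ∅, blockMat e 0 {0}} := by
    intro X k hk l
    obtain ⟨j, hj⟩ := exists_nat_cast h (l - k)
    have : ∀ j : ℕ, blockMat e (k + j) X ∈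
        genSet bmul {blockMat e 1 ∅, blockMat e 0 {0}} := by
      intro j
      induction j with
      | zero => simpa using hk
      | succ j ih =>
        have := genSet_mul bmul _ ih (g := blockMat e 1 ∅) (by simp)
        rw [blockMat_mul_one] at this
        simpa [add_assoc] using this
    have := this j
    rw [hj] at this
    simpa using this
  induction X using Finset.induction_on with
  | empty => exact key ∅ 1 ⟨blockMat e 1 ∅, [], Or.inl rfl, by simp, rfl⟩
  | insert a X _ ih =>
    apply key _ (-a)
    have := genSet_mul bmul _ (ih (-a)) (g := blockMat e 0 {0}) (by simp)
    rw [blockMat_mul_two] at this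
    simpa using this

/-- For every odd `n ≥ 1`, two `n × n` Boolean matrices generate a subsemigroup with at least
`((n² − 1)/4) · 2^((n² − 1)/4)` elements. -/
theorem stmt1 (n : ℕ) (hn : 1 ≤ n) (hodd : Odd n) :
    ∃ M₁ M₂ : Matrix (Fin n) (Fin n) Bool,
      ((n ^ 2 - 1) / 4) * 2 ^ ((n ^ 2 - 1) / 4)
        ≤ Set.ncard (genSet bmul {M₁, M₂}) := by
  obtain ⟨m, rfl⟩ := hodd
  have hm : ((2 * m + 1) ^ 2 - 1) / 4 = m * (m + 1) := by
    have : (2 * m + 1) ^ 2 - 1 = 4 * (m * (m + 1)) := by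
      have : (2 * m + 1) ^ 2 = 4 * (m * (m + 1)) + 1 := by ring
      omega
    omega
  rw [hm]
  rcases Nat.eq_zero_or_pos m with rfl | hpos
  · exact ⟨0, 0, by simp⟩
  have : NeZero m := ⟨hpos.ne'⟩
  have e : Fin (2 * m + 1) ≃ ZMod m ⊕ ZMod (m + 1) := by
    apply Fintype.equivOfCardEq
    rw [Fintype.card_sum, ZMod.card, ZMod.card, Fintype.card_fin]
    ring
  refine ⟨blockMat e 1 ∅, blockMat e 0 {0}, ?_⟩
  have hsub : Set.range (fun x : (ZMod m × ZMod (m + 1)) × Finset (ZMod m × ZMod (m + 1)) =>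
      blockMat e x.1 x.2) ⊆ genSet bmul {blockMat e 1 ∅, blockMat e 0 {0}} := by
    rintro _ ⟨x, rfl⟩
    exact blockMat_mem (by simp) e x.2 x.1
  have hcard := Set.ncard_le_ncard hsub (Set.toFinite _)
  rw [← Nat.card_coe_set_eq, Nat.card_range_of_injective (blockMat_inj e),
    Nat.card_eq_fintype_card, Fintype.card_prod, Fintype.card_finset, Fintype.card_prod,
    ZMod.card, ZMod.card] at hcard
  exact hcard
end

section
/- Let A = (Q, Σ, δ) be a deterministic automaton with |Q| = n and all events observable, and let S ⊆ Q × 2^Q. Then the language ⋃_{(s,T)∈S} L_m(A, {s}, T) is accepted by a deterministic finite automaton with at most (n+1)^n states. -/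
/-- One step of the extended transition function: `δ(S, a) = ⋃_{q ∈ S} δ(q, a)`. -/
def nstep {Q A : Type*} (δ : Q → A → Set Q) (S : Set Q) (a : A) : Set Q :=
  ⋃ q ∈ S, δ q a

/-- The extended transition function `δ : 2^Q × Σ* → 2^Q`. -/
def nrun {Q A : Type*} (δ : Q → A → Set Q) (S : Set Q) : List A → Set Q
  | [] => S
  | a :: w => nrun δ (nstep δ S a) w

/-- For a deterministic automaton with `n` states and `S ⊆ Q × 2^Q`, the language
`⋃_{(s,T) ∈ S} L_m(A, {s}, T)` is accepted by a DFA with at most `(n+1)^n` states. -/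
theorem stmt3 {Q A : Type*} [Fintype Q] (n : ℕ) (hcard : Fintype.card Q = n)
    (δ : Q → A → Set Q) (hdet : ∀ q a, (δ q a).Subsingleton)
    (S : Set (Q × Set Q)) :
    ∃ (σ : Type) (_ : Fintype σ) (M : DFA A σ),
      Fintype.card σ ≤ (n + 1) ^ n ∧
      M.accepts = ⋃ p ∈ S, {w : List A | (nrun δ {p.1} w ∩ p.2).Nonempty} := by
  classical
  subst hcard
  let e := Fintype.equivFin Q
  let toSet : Option (Fin (Fintype.card Q)) → Set Q := fun o => {q | o = some (e q)}
  have hpick : ∀ X : Set Q, ∃ o, X.Subsingleton → toSet o = X := by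
    intro X
    by_cases hX : X.Subsingleton
    · rcases hX.eq_empty_or_singleton with h | ⟨q, h⟩
      · exact ⟨none, fun _ => by subst h; ext x; simp [toSet]⟩
      · exact ⟨some (e q), fun _ => by subst h; ext x; simp [toSet, eq_comm]⟩
    · exact ⟨none, fun h => absurd h hX⟩
  choose pick hpick using hpick
  have hsub : ∀ o a, (nstep δ (toSet o) a).Subsingleton := by
    intro o a x hx y hy
    simp only [nstep, Set.mem_iUnion, toSet, Set.mem_ofPred_eq, exists_prop] at hx hy
    obtain ⟨q, hq, hx⟩ := hx
    obtain ⟨r, hr, hy⟩ := hy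
    have : q = r := e.injective (Option.some.inj (hq.symm.trans hr))
    subst this
    exact hdet q a hx hy
  let M : DFA A (Fin (Fintype.card Q) → Option (Fin (Fintype.card Q))) :=
    { step := fun f a i => pick (nstep δ (toSet (f i)) a)
      start := fun i => some i
      accept := {f | ∃ p ∈ S, (toSet (f (e p.1)) ∩ p.2).Nonempty} }
  have hrun : ∀ (w : List A) f i, toSet (M.evalFrom f w i) = nrun δ (toSet (f i)) w := by
    intro w
    induction w with
    | nil => intro f i; rfl
    | cons a w ih =>
      intro f i
      have h1 : M.evalFrom f (a :: w) = M.evalFrom (M.step f a) w := rfl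
      rw [h1, ih]
      have h2 : toSet (M.step f a i) = nstep δ (toSet (f i)) a := hpick _ (hsub _ _)
      rw [h2]
      rfl
  refine ⟨_, inferInstance, M, by simp, ?_⟩
  ext w
  have hs : ∀ q, toSet (M.start (e q)) = {q} := by
    intro q; ext x; simp [toSet, M, eq_comm]
  have h3 : w ∈ M.accepts ↔
      ∃ p ∈ S, (toSet (M.evalFrom M.start w (e p.1)) ∩ p.2).Nonempty := Iff.rfl
  rw [h3]
  simp only [hrun, hs]
  refine Iff.trans ?_ (Set.mem_iUnion₂ (γ := List A)).symm
  simp only [exists_prop, Set.mem_ofPred_eq]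
end

section
/- Let A = (Q, Σ, δ) be an automaton with |Q| = n whose reachability relation is a partial order (i.e., A is partially ordered). Then the set { R_w : w ∈ Σ* } of relations induced by strings has at most 2^(n(n+1)/2) elements. -/
/-- The relation `R_w ⊆ Q × Q` induced by a string `w`: `(p, q) ∈ R_w` iff `q ∈ δ({p}, w)`. -/
def relOf {Q A : Type*} (δ : Q → A → Set Q) (w : List A) : Set (Q × Q) :=
  {pq | pq.2 ∈ nrun δ {pq.1} w}

/-- If the reachability relation of an automaton with `n` states is a partial order (i.e., the
automaton is partially ordered), then the set of relations induced by strings has at most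
`2^(n(n+1)/2)` elements. -/
theorem stmt7 {Q A : Type*} [Fintype Q] (n : ℕ) (hcard : Fintype.card Q = n)
    (δ : Q → A → Set Q)
    (hpo : IsPartialOrder Q (fun p q => ∃ w : List A, q ∈ nrun δ {p} w)) :
    Set.ncard {R : Set (Q × Q) | ∃ w : List A, R = relOf δ w}
      ≤ 2 ^ (n * (n + 1) / 2) := by
  classical
  let P : Set (Q × Q) := {pq | ∃ w : List A, pq.2 ∈ nrun δ {pq.1} w}
  have hsub : {R : Set (Q × Q) | ∃ w : List A, R = relOf δ w} ⊆ 𝒫 P := by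
    rintro R ⟨w, rfl⟩ x hx
    exact ⟨w, hx⟩
  have h1 := Set.ncard_le_ncard hsub (Set.toFinite _)
  rw [Set.ncard_powerset P (Set.toFinite _)] at h1
  refine h1.trans (Nat.pow_le_pow_right (by norm_num) ?_)
  have hswap : (Prod.swap '' P).ncard = P.ncard :=
    Set.ncard_image_of_injective _ Prod.swap_injective
  have hui := Set.ncard_union_add_ncard_inter P (Prod.swap '' P) (Set.toFinite _) (Set.toFinite _)
  have hu : (P ∪ Prod.swap '' P).ncard ≤ n * n := by
    refine (Set.ncard_le_ncard (Set.subset_univ _) (Set.toFinite _)).trans ?_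
    rw [Set.ncard_univ, Nat.card_eq_fintype_card, Fintype.card_prod, hcard]
  have hi : (P ∩ Prod.swap '' P).ncard ≤ n := by
    have hd : P ∩ Prod.swap '' P ⊆ (fun q : Q => (q, q)) '' Set.univ := by
      rintro ⟨p, q⟩ ⟨h, ⟨⟨a, b⟩, h', he⟩⟩
      simp only [Prod.swap_prod_mk, Prod.mk.injEq] at he
      obtain ⟨rfl, rfl⟩ := he
      have this : b = a := hpo.antisymm _ _ h h'
      exact ⟨b, trivial, by rw [this]⟩
    refine (Set.ncard_le_ncard hd (Set.toFinite _)).trans ?_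
    refine (Set.ncard_image_le (Set.toFinite _)).trans ?_
    rw [Set.ncard_univ, Nat.card_eq_fintype_card, hcard]
  rw [Nat.le_div_iff_mul_le (by norm_num)]
  rw [hswap] at hui
  nlinarith
end

section
/- Let A = (Q, Σ, δ) be a deterministic partially ordered automaton with |Q| = n. Then the set { δ_w : w ∈ Σ* } of partial functions on Q induced by strings has at most (n+1)! elements. -/
open Classical in
theorem prod_up_le {Q : Type*} [PartialOrder Q] (k : ℕ) : ∀ s : Finset Q, s.card = k →
    ∏ q ∈ s, ((s.filter (fun r => q ≤ r)).card + 1) ≤ Nat.factorial (k + 1) := by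
  induction k with
  | zero =>
    intro s hs
    rw [Finset.card_eq_zero] at hs
    subst hs
    simp
  | succ k ih =>
    intro s hs
    have hne : s.Nonempty := Finset.card_pos.mp (by omega)
    obtain ⟨m, hm, hmin⟩ := s.exists_minimal hne
    have hc : (s.erase m).card = k := by rw [Finset.card_erase_of_mem hm]; omega
    rw [← Finset.mul_prod_erase s _ hm, Nat.factorial_succ]
    apply Nat.mul_le_mul
    · have := Finset.card_filter_le s (fun r => m ≤ r)
      omega
    · refine le_trans (le_of_eq ?_) (ih _ hc)
      apply Finset.prod_congr rfl
      intro q hq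
      rw [Finset.mem_erase] at hq
      congr 2
      ext r
      simp only [Finset.mem_filter, Finset.mem_erase]
      constructor
      · rintro ⟨h1, h2⟩
        refine ⟨⟨?_, h1⟩, h2⟩
        rintro rfl
        exact hq.1 (le_antisymm h2 (hmin hq.2 h2))
      · rintro ⟨⟨_, h1⟩, h2⟩
        exact ⟨h1, h2⟩

/-- If `A` is a deterministic partially ordered automaton with `n` states, then the set of
partial functions on `Q` induced by strings (`f : Q → Option Q` with
`f q = some r ↔ r ∈ δ({q}, w)`) has at most `(n+1)!` elements. -/
theorem stmt9 {Q A : Type*} [Fintype Q] (n : ℕ) (hcard : Fintype.card Q = n)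
    (δ : Q → A → Set Q) (hdet : ∀ q a, (δ q a).Subsingleton)
    (hpo : IsPartialOrder Q (fun p q => ∃ w : List A, q ∈ nrun δ {p} w)) :
    Set.ncard {f : Q → Option Q | ∃ w : List A, ∀ q r, r ∈ nrun δ {q} w ↔ f q = some r}
      ≤ Nat.factorial (n + 1) := by
  classical
  let P : PartialOrder Q :=
    { le := fun p q => ∃ w : List A, q ∈ nrun δ {p} w
      le_refl := fun a => hpo.refl a
      le_trans := fun a b c => hpo.trans a b c
      le_antisymm := fun a b => hpo.antisymm a b }
  have key := prod_up_le n (Finset.univ : Finset Q) (by rw [Finset.card_univ, hcard])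
  refine le_trans ?_ key
  let T : Finset (Q → Option Q) := Fintype.piFinset (fun q =>
    insert none ((Finset.univ.filter (fun r => q ≤ r)).image some))
  have hsub : {f : Q → Option Q | ∃ w : List A, ∀ q r, r ∈ nrun δ {q} w ↔ f q = some r}
      ⊆ (T : Set (Q → Option Q)) := by
    rintro f ⟨w, hw⟩
    rw [Finset.mem_coe, Fintype.mem_piFinset]
    intro q
    cases h : f q with
    | none => simp
    | some r =>
      have : q ≤ r := ⟨w, (hw q r).2 h⟩
      simp [this]
  refine le_trans (Set.ncard_le_ncard hsub T.finite_toSet) ?_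
  rw [Set.ncard_coe_finset, Fintype.card_piFinset]
  apply Finset.prod_le_prod'
  intro q _
  refine le_trans (Finset.card_insert_le _ _) ?_
  exact Nat.add_le_add_right Finset.card_image_le 1
end

section
/- Let f : ℕ → ℕ be a function with f(n) > n for all n and lim_{n→∞} f(n)/n² = 0. For each n, let E(n) be the average, over all pairs (M₁, M₂) of n×n Boolean matrices each having exactly f(n) entries equal to 1, of the cardinality of the subsemigroup generated by {M₁, M₂} under Boolean matrix multiplication. Then there exists a function g : ℕ → ℝ with lim_{n→∞} g(n)/n² = 0 such that E(n) ≥ 2^(n²/4 − g(n)) for all sufficiently large n. -/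
open Filter

/-- The `n × n` Boolean matrices having exactly `k` entries equal to `1`. -/
noncomputable def matricesWithOnes (n k : ℕ) : Finset (Matrix (Fin n) (Fin n) Bool) :=
  Finset.univ.filter fun M =>
    (Finset.univ.filter fun ij : Fin n × Fin n => M ij.1 ij.2 = true).card = k

/-- The average, over all pairs `(M₁, M₂)` of `n × n` Boolean matrices each having exactly `k`
ones, of the cardinality of the subsemigroup generated by `{M₁, M₂}` under Boolean matrix
multiplication. -/
noncomputable def avgSemigroupSize (n k : ℕ) : ℝ :=
  (∑ p ∈ matricesWithOnes n k ×ˢ matricesWithOnes n k,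
      (Set.ncard (genSet bmul {p.1, p.2}) : ℝ))
    / ((matricesWithOnes n k ×ˢ matricesWithOnes n k).card : ℝ)


namespace BoolSG

open Finset

lemma bmul_true {n : ℕ} (a b : Matrix (Fin n) (Fin n) Bool) (i j : Fin n) :
    bmul a b i j = true ↔ ∃ k, a i k = true ∧ b k j = true := by
  simp [bmul]

lemma bmul_assoc {n : ℕ} (a b c : Matrix (Fin n) (Fin n) Bool) :
    bmul (bmul a b) c = bmul a (bmul b c) := by
  ext i j
  rw [Bool.eq_iff_iff]
  simp only [bmul_true]
  constructor
  · rintro ⟨k, ⟨l, h1, h2⟩, h3⟩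
    exact ⟨l, h1, k, h2, h3⟩
  · rintro ⟨l, h1, k, h2, h3⟩
    exact ⟨k, ⟨l, h1, h2⟩, h3⟩

lemma foldl_bmul {n : ℕ} (x y : Matrix (Fin n) (Fin n) Bool)
    (t : List (Matrix (Fin n) (Fin n) Bool)) :
    bmul x (t.foldl bmul y) = t.foldl bmul (bmul x y) := by
  induction t generalizing y with
  | nil => rfl
  | cons z t ih => simp only [List.foldl_cons]; rw [ih, bmul_assoc]

lemma gen_mul {n : ℕ} {G : Set (Matrix (Fin n) (Fin n) Bool)}
    {x y : Matrix (Fin n) (Fin n) Bool} (hx : x ∈ genSet bmul G) (hy : y ∈ genSet bmul G) :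
    bmul x y ∈ genSet bmul G := by
  obtain ⟨h, t, hh, ht, rfl⟩ := hx
  obtain ⟨h', t', hh', ht', rfl⟩ := hy
  refine ⟨h, t ++ h' :: t', hh, ?_, ?_⟩
  · intro m hm
    rcases List.mem_append.1 hm with hm | hm
    · exact ht m hm
    · rcases List.mem_cons.1 hm with rfl | hm
      · exact hh'
      · exact ht' m hm
  · rw [List.foldl_append, List.foldl_cons, foldl_bmul]

lemma gen_base {n : ℕ} {G : Set (Matrix (Fin n) (Fin n) Bool)}
    {x : Matrix (Fin n) (Fin n) Bool} (hx : x ∈ G) : x ∈ genSet bmul G :=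
  ⟨x, [], hx, by simp, rfl⟩

/-- The `V`-rows of `M` are given by the relation `R` on `V` and vanish on `K`. -/
def Top {V K : Type} {n : ℕ} (e : V ⊕ K ≃ Fin n) (M : Matrix (Fin n) (Fin n) Bool)
    (R : V → V → Prop) : Prop :=
  (∀ v w, M (e (.inl v)) (e (.inl w)) = true ↔ R v w) ∧
    ∀ v k, ¬ M (e (.inl v)) (e (.inr k)) = true

lemma Top.mul {V K : Type} {n : ℕ} {e : V ⊕ K ≃ Fin n} {M M' : Matrix (Fin n) (Fin n) Bool}
    {R R' : V → V → Prop} (h : Top e M R) (hh : Top e M' R') :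
    Top e (bmul M M') (fun v w => ∃ u, R v u ∧ R' u w) := by
  constructor
  · intro v w
    rw [bmul_true, e.surjective.exists]
    simp [h.1, h.2, hh.1]
  · intro v k
    rw [bmul_true, e.surjective.exists]
    simp [hh.2, h.2]

/-- shift by `s` on both blocks, with `S` as the corner block -/
def rel (a b : ℕ) (s : ℕ) (S : ZMod a → ZMod b → Prop) :
    ZMod a ⊕ ZMod b → ZMod a ⊕ ZMod b → Prop
  | .inl x, .inl y => y = x + s
  | .inr x, .inr y => y = x + s
  | .inl x, .inr y => S x y
  | .inr _, .inl _ => False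

lemma rel_comp (a b s t : ℕ) (S S' : ZMod a → ZMod b → Prop) :
    (fun v w => ∃ u, rel a b s S v u ∧ rel a b t S' u w) =
      rel a b (s + t) (fun x y => S x (y - t) ∨ S' (x + s) y) := by
  funext v w
  apply propext
  rcases v with v | v <;> rcases w with w | w <;> simp [rel, add_assoc]
  constructor
  · rintro (h | ⟨u, h, rfl⟩)
    · exact Or.inr h
    · left; simpa using h
  · rintro (h | h)
    · exact Or.inr ⟨_, h, by simp⟩
    · exact Or.inl h

lemma exists_matrix {V K : Type} [Fintype V] [DecidableEq V] [Fintype K] [DecidableEq K] {n : ℕ}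
    (e : V ⊕ K ≃ Fin n) (R : V → V → Prop) (c m f : ℕ) (F : Finset (V × V))
    (hF : ∀ v w, (v, w) ∈ F ↔ R v w) (hc : F.card = c) (hf : c + m = f)
    (hm : m ≤ Fintype.card K * n) :
    ∃ M ∈ matricesWithOnes n f, Top e M R := by
  classical
  have hcard : Fintype.card (V ⊕ K) = n := by simpa using Fintype.card_congr e
  obtain ⟨T, -, hT⟩ : ∃ T ⊆ (univ : Finset (K × (V ⊕ K))), T.card = m := by
    apply Finset.exists_subset_card_eq
    rw [Finset.card_univ, Fintype.card_prod, hcard]; exact hm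
  let i1 : V × V ↪ (V ⊕ K) × (V ⊕ K) :=
    ⟨fun p => (.inl p.1, .inl p.2), fun p q h => by
      simp only [Prod.mk.injEq, Sum.inl.injEq] at h; exact Prod.ext h.1 h.2⟩
  let i2 : K × (V ⊕ K) ↪ (V ⊕ K) × (V ⊕ K) :=
    ⟨fun p => (.inr p.1, p.2), fun p q h => by
      simp only [Prod.mk.injEq, Sum.inr.injEq] at h; exact Prod.ext h.1 h.2⟩
  have hi1 : ∀ p, i1 p = (.inl p.1, .inl p.2) := fun _ => rfl
  have hi2 : ∀ p, i2 p = (.inr p.1, p.2) := fun _ => rfl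
  clear_value i1 i2
  let O := F.map i1 ∪ T.map i2
  have hO : O.card = f := by
    rw [Finset.card_union_of_disjoint, Finset.card_map, Finset.card_map, hc, hT, hf]
    rw [Finset.disjoint_left]
    intro p hp hq
    simp only [Finset.mem_map] at hp hq
    obtain ⟨x, -, rfl⟩ := hp
    obtain ⟨y, -, h⟩ := hq
    simp [hi1, hi2] at h
  refine ⟨fun i j => decide ((e.symm i, e.symm j) ∈ O), ?_, ?_, ?_⟩
  · refine Finset.mem_filter.2 ⟨Finset.mem_univ _, ?_⟩
    rw [← hO, ← Finset.card_map (e.prodCongr e).toEmbedding]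
    congr 1
    ext p
    simp only [Finset.mem_filter, Finset.mem_univ, true_and, Finset.mem_map_equiv,
      decide_eq_true_eq]
    rfl
  · intro v w
    rw [← hF]
    simp [O, hi1, hi2]
  · intro v k
    simp [O, hi1, hi2]

lemma gen_large {n a b k f : ℕ} (ha : 1 ≤ a) (hb : 1 ≤ b) (hab : a.Coprime b)
    (hn : a + b + k = n) (hf : a + b + 1 ≤ f) (hf2 : f ≤ a + b + k * n) :
    ∃ M₁ ∈ matricesWithOnes n f, ∃ M₂ ∈ matricesWithOnes n f,
      2 ^ (a * b) ≤ Set.ncard (genSet bmul {M₁, M₂}) := by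
  classical
  have : NeZero a := ⟨by omega⟩
  have : NeZero b := ⟨by omega⟩
  obtain ⟨e⟩ : Nonempty ((ZMod a ⊕ ZMod b) ⊕ Fin k ≃ Fin n) := by
    refine ⟨Fintype.equivFinOfCardEq ?_⟩
    simp [ZMod.card, hn]
  have hinj : ∀ σ : ZMod a ⊕ ZMod b → ZMod a ⊕ ZMod b,
      (univ.image fun v => (v, σ v)).card = a + b := by
    intro σ
    rw [Finset.card_image_of_injective]
    · simp [ZMod.card]
    · intro x y h
      exact (Prod.mk.inj h).1
  obtain ⟨P, hP, tP⟩ := exists_matrix e (rel a b 1 fun _ _ => False) (a + b) (f - (a + b)) f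
    (univ.image fun v => (v, Sum.map (· + 1) (· + 1) v))
    (by
      rintro (v | v) (w | w) <;> simp [rel, eq_comm])
    (hinj _) (by omega) (by simp; omega)
  obtain ⟨Q, hQ, tQ⟩ := exists_matrix e (rel a b 0 fun x y => x = 0 ∧ y = 0)
    (a + b + 1) (f - (a + b + 1)) f
    (insert (.inl 0, .inr 0) (univ.image fun v => (v, id v)))
    (by
      rintro (v | v) (w | w) <;> simp [rel, eq_comm])
    (by
      rw [Finset.card_insert_of_notMem, hinj]
      simp) (by omega) (by simp; omega)
  refine ⟨P, hP, Q, hQ, ?_⟩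
  set G := genSet bmul {P, Q} with hG
  have gP : P ∈ G := gen_base (by simp)
  have gQ : Q ∈ G := gen_base (by simp)
  have pows : ∀ t : ℕ, ∃ M ∈ G, Top e M (rel a b (t + 1) fun _ _ => False) := by
    intro t
    induction t with
    | zero => exact ⟨P, gP, by simpa using tP⟩
    | succ t ih =>
      obtain ⟨M, hM, tM⟩ := ih
      refine ⟨bmul M P, gen_mul hM gP, ?_⟩
      have := tM.mul tP
      rw [rel_comp] at this
      simpa using this
  have hzero : ∀ m S, (a * b ∣ m) → rel a b m S = rel a b 0 S := by
    intro m S h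
    have h1 : (m : ZMod a) = 0 := (ZMod.natCast_eq_zero_iff _ _).2 (dvd_trans ⟨b, rfl⟩ h)
    have h2 : (m : ZMod b) = 0 := (ZMod.natCast_eq_zero_iff _ _).2 (dvd_trans ⟨a, mul_comm _ _⟩ h)
    funext v w
    rcases v with v | v <;> rcases w with w | w <;> simp [rel, h1, h2]
  have habpos : 1 ≤ a * b := Nat.mul_pos ha hb
  have empt : ∃ M ∈ G, Top e M (rel a b 0 fun _ _ => False) := by
    obtain ⟨M, hM, tM⟩ := pows (a * b - 1)
    refine ⟨M, hM, ?_⟩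
    rw [hzero _ _ ⟨1, by omega⟩] at tM
    exact tM
  have single : ∀ x y, ∃ M ∈ G, Top e M (rel a b 0 fun x' y' => x' = x ∧ y' = y) := by
    intro x y
    obtain ⟨t, ht1, ht2⟩ := Nat.chineseRemainder hab x.val y.val
    have e1 : (t : ZMod a) = x := by
      rw [(ZMod.natCast_eq_natCast_iff _ _ _).2 ht1]; simp
    have e2 : (t : ZMod b) = y := by
      rw [(ZMod.natCast_eq_natCast_iff _ _ _).2 ht2]; simp
    -- `q` is the positive exponent on the right, `p` the one on the left
    obtain ⟨p, hp⟩ : ∃ p, (p + 1) + (t + a * b) = a * b * (t + 2) := by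
      refine ⟨a * b * (t + 2) - (t + a * b) - 1, ?_⟩
      have : a * b * (t + 2) = a * b * t + a * b + a * b := by ring
      have : t ≤ a * b * t := Nat.le_mul_of_pos_left _ habpos
      omega
    obtain ⟨q, hq⟩ : ∃ q, q + 1 = t + a * b := ⟨t + a * b - 1, by omega⟩
    obtain ⟨M, hM, tM⟩ := pows p
    obtain ⟨M', hM', tM'⟩ := pows q
    refine ⟨bmul (bmul M Q) M', gen_mul (gen_mul hM gQ) hM', ?_⟩
    have h := (tM.mul tQ)
    rw [rel_comp] at h
    have h := h.mul tM'
    rw [rel_comp, hzero _ _ ⟨t + 2, by rw [← hp, ← hq]⟩] at h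
    have hpa : ((p + 1 : ℕ) : ZMod a) = - x := by
      have := congrArg (Nat.cast : ℕ → ZMod a) hp
      push_cast at this ⊢
      simp [e1] at this
      linear_combination this
    have hqb : ((q + 1 : ℕ) : ZMod b) = y := by
      rw [hq]; simp [e2]
    rw [hqb, hpa] at h
    convert h using 4 with x' y'
    simp [sub_eq_zero, ← sub_eq_add_neg]
  have all : ∀ S : Finset (ZMod a × ZMod b), ∃ M ∈ G,
      Top e M (rel a b 0 fun x y => (x, y) ∈ S) := by
    intro S
    induction S using Finset.induction_on with
    | empty => simpa using empt
    | insert p S _ ih =>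
      obtain ⟨M, hM, tM⟩ := ih
      obtain ⟨M', hM', tM'⟩ := single p.1 p.2
      refine ⟨bmul M' M, gen_mul hM' hM, ?_⟩
      have := tM'.mul tM
      rw [rel_comp] at this
      convert this using 4 with x y
      simp [Prod.ext_iff]
  choose Φ hΦ tΦ using all
  have Φinj : Function.Injective Φ := by
    intro S S' h
    ext ⟨x, y⟩
    have h1 := (tΦ S).1 (.inl x) (.inr y)
    have h2 := (tΦ S').1 (.inl x) (.inr y)
    rw [h] at h1
    exact h1.symm.trans h2
  calc 2 ^ (a * b) = (Set.univ : Set (Finset (ZMod a × ZMod b))).ncard := by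
        simp [Set.ncard_univ, ZMod.card]
    _ ≤ G.ncard := Set.ncard_le_ncard_of_injOn Φ (fun S _ => hΦ S) Φinj.injOn (Set.toFinite _)

lemma card_ones (n k : ℕ) : (matricesWithOnes n k).card ≤ (n ^ 2).choose k := by
  classical
  have h : (Finset.powersetCard k (univ : Finset (Fin n × Fin n))).card = (n ^ 2).choose k := by
    rw [Finset.card_powersetCard]; simp [sq]
  rw [← h]
  apply Finset.card_le_card_of_injOn
    (fun M => univ.filter fun ij : Fin n × Fin n => M ij.1 ij.2 = true)
  · intro M hM
    simpa [matricesWithOnes, Finset.mem_powersetCard] using hM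
  · intro M _ M' _ h
    ext i j
    have := congrArg (fun s => (i, j) ∈ s) h
    rw [Bool.eq_iff_iff]
    simpa using this

lemma choose_bound (N f : ℕ) (hf : 0 < f) (hN : 0 < N) :
    ((N.choose f : ℕ) : ℝ) ≤ Real.exp (N * ((f : ℝ) / N + Real.negMulLog ((f : ℝ) / N))) := by
  set x : ℝ := (f : ℝ) / N with hx
  have hN' : (0 : ℝ) < N := by exact_mod_cast hN
  have hx0 : 0 < x := by positivity
  by_cases hfN : f ≤ N
  · have h1 : x ^ f * (N.choose f : ℝ) ≤ (x + 1) ^ N := by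
      rw [add_pow]
      have := Finset.single_le_sum (f := fun m => x ^ m * 1 ^ (N - m) * (N.choose m : ℝ))
        (s := Finset.range (N + 1)) (fun i _ => by positivity)
        (Finset.mem_range.2 (Nat.lt_succ_of_le hfN))
      simpa using this
    have h2 : (x + 1) ^ N ≤ Real.exp (N * x) := by
      rw [Real.exp_nat_mul]
      exact pow_le_pow_left₀ (by positivity) (Real.add_one_le_exp x) _
    have h3 : x ^ f = Real.exp (-(N * Real.negMulLog x)) := by
      rw [← Real.rpow_natCast, Real.rpow_def_of_pos hx0]
      congr 1
      have : (f : ℝ) = N * x := by rw [hx]; field_simp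
      rw [Real.negMulLog, this]; ring
    rw [h3] at h1
    have h4 := h1.trans h2
    rw [mul_add, Real.exp_add]
    rw [Real.exp_neg, inv_mul_le_iff₀ (Real.exp_pos _)] at h4
    linarith
  · rw [Nat.choose_eq_zero_of_lt (by omega)]
    simpa using (Real.exp_pos _).le

lemma avg_aux {α : Type*} (s : Finset α) (F : α × α → ℝ) (hF : ∀ p, 0 ≤ F p) {u v : α}
    (hu : u ∈ s) (hv : v ∈ s) {A B : ℝ} (hA : A ≤ F (u, v)) (hB : (s.card : ℝ) ≤ B)
    (hA0 : 0 ≤ A) :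
    A / B ^ 2 ≤ (∑ p ∈ s ×ˢ s, F p) / ((s ×ˢ s).card : ℝ) := by
  have hpos : (0 : ℝ) < s.card := by
    exact_mod_cast Finset.card_pos.2 ⟨u, hu⟩
  have hs := Finset.single_le_sum (s := s ×ˢ s) (f := F) (fun p _ => hF p)
    (Finset.mk_mem_product hu hv)
  rw [Finset.card_product]
  push_cast
  rw [← sq]
  exact div_le_div₀ (hA0.trans (hA.trans hs)) (hA.trans hs) (by positivity)
    (pow_le_pow_left₀ hpos.le hB 2)

lemma avg_ge {n k c : ℕ} (h : ∃ M₁ ∈ matricesWithOnes n k, ∃ M₂ ∈ matricesWithOnes n k,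
      2 ^ c ≤ Set.ncard (genSet bmul {M₁, M₂})) {B : ℝ}
    (hB : ((matricesWithOnes n k).card : ℝ) ≤ B) :
    (2 : ℝ) ^ c / B ^ 2 ≤ avgSemigroupSize n k := by
  obtain ⟨M₁, h1, M₂, h2, h⟩ := h
  have h' : (2 : ℝ) ^ c ≤ (Set.ncard (genSet bmul {M₁, M₂}) : ℝ) := by exact_mod_cast h
  exact avg_aux (matricesWithOnes n k) (fun p => (Set.ncard (genSet bmul {p.1, p.2}) : ℝ))
    (fun p => Nat.cast_nonneg _) h1 h2 h' hB (by positivity)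

end BoolSG

/-- If `f(n) > n` and `f(n)/n² → 0`, then the average size `E(n)` of the semigroup generated by
two random `n × n` Boolean matrices, each with `f(n)` ones, satisfies
`E(n) ≥ 2^(n²/4 − g(n))` for large `n`, for some `g` with `g(n)/n² → 0`. -/
theorem stmt16 (f : ℕ → ℕ) (hf : ∀ n, n < f n)
    (hlim : Tendsto (fun n => (f n : ℝ) / (n : ℝ) ^ 2) atTop (nhds 0)) :
    ∃ g : ℕ → ℝ,
      Tendsto (fun n => g n / (n : ℝ) ^ 2) atTop (nhds 0) ∧
      ∃ N : ℕ, ∀ n ≥ N,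
        (2 : ℝ) ^ ((n : ℝ) ^ 2 / 4 - g n) ≤ avgSemigroupSize n (f n) := by
  let x : ℕ → ℝ := fun n => (f n : ℝ) / (n : ℝ) ^ 2
  let y : ℕ → ℝ := fun n => x n + Real.negMulLog (x n)
  refine ⟨fun n => 2 * ((n : ℝ) ^ 2 * y n) / Real.log 2 + f n / 2 + n, ?_, ?_⟩
  · have hy : Tendsto y atTop (nhds 0) := by
      have h := (Real.continuous_negMulLog.tendsto 0).comp hlim
      simpa using hlim.add h
    have hn : Tendsto (fun n : ℕ => (1 : ℝ) / n) atTop (nhds 0) :=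
      tendsto_one_div_atTop_nhds_zero_nat
    have h : Tendsto (fun n => y n * (2 / Real.log 2) + x n * (1 / 2) + 1 / (n : ℝ))
        atTop (nhds 0) := by
      have hx : Tendsto x atTop (nhds 0) := hlim
      simpa only [zero_mul, add_zero] using ((hy.mul_const (2 / Real.log 2)).add (hx.mul_const (1 / 2))).add hn
    refine h.congr' ?_
    filter_upwards [eventually_gt_atTop 0] with n hn0
    have : (0 : ℝ) < n := by exact_mod_cast hn0
    have hl : 0 < Real.log 2 := Real.log_pos (by norm_num)
    simp only [x]
    field_simp
  · have hev : ∀ᶠ n : ℕ in atTop, x n < 1 / 2 ∧ 10 ≤ n :=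
      (hlim.eventually (gt_mem_nhds (by norm_num))).and (eventually_ge_atTop 10)
    obtain ⟨N, hN⟩ := eventually_atTop.1 hev
    refine ⟨N, fun n hn => ?_⟩
    obtain ⟨hx, h10⟩ := hN n hn
    have hn0 : (0 : ℝ) < n := by exact_mod_cast (by omega : 0 < n)
    have hfn := hf n
    have hf2 : 2 * f n < n ^ 2 := by
      have : (2 * f n : ℝ) < (n : ℝ) ^ 2 := by
        have := (div_lt_iff₀ (by positivity)).1 hx
        linarith
      exact_mod_cast this
    obtain ⟨d, hd⟩ : ∃ d, d = f n / n := ⟨_, rfl⟩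
    have hd1 : n * d ≤ f n := by rw [hd]; exact Nat.mul_div_le _ _
    have hd2 : f n < n * (d + 1) := by
      rw [hd]; exact Nat.lt_mul_div_succ _ (by omega)
    have hd3 : 2 * d < n := by
      by_contra hc
      push Not at hc
      nlinarith
    obtain ⟨a, ha⟩ : ∃ a, a = (n - d - 2) / 2 := ⟨_, rfl⟩
    have ha1 : 1 ≤ a := by omega
    have ha2 : 2 * a + 1 + d + 1 ≤ n := by omega
    have ha3 : n ≤ 2 * a + d + 3 := by omega
    obtain ⟨k, hk⟩ : ∃ k, a + (a + 1) + k = n := ⟨n - (a + (a + 1)), by omega⟩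
    have hkd : d + 1 ≤ k := by omega
    have hkn : n * (d + 1) ≤ k * n := by rw [mul_comm k]; exact Nat.mul_le_mul_left _ hkd
    have hlarge := BoolSG.gen_large (n := n) (a := a) (b := a + 1) (k := k) (f := f n) ha1
      (by omega) (by simp) hk (by omega) (by omega)
    have hB : ((matricesWithOnes n (f n)).card : ℝ) ≤ Real.exp ((n : ℝ) ^ 2 * y n) := by
      have h1 := BoolSG.choose_bound (n ^ 2) (f n) (by omega) (by positivity)
      push_cast at h1
      exact le_trans (by exact_mod_cast BoolSG.card_ones n (f n)) h1
    refine le_trans ?_ (BoolSG.avg_ge hlarge hB)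
    have hl : 0 < Real.log 2 := Real.log_pos (by norm_num)
    have hE : Real.exp ((n : ℝ) ^ 2 * y n) ^ 2
        = (2 : ℝ) ^ (2 * ((n : ℝ) ^ 2 * y n) / Real.log 2) := by
      rw [Real.rpow_def_of_pos (by norm_num), ← Real.exp_nat_mul]
      congr 1
      field_simp
      push_cast
      ring
    rw [hE, ← Real.rpow_natCast 2 (a * (a + 1)), ← Real.rpow_sub (by norm_num)]
    apply Real.rpow_le_rpow_of_exponent_le (by norm_num)
    have h1 : (n : ℝ) ≤ 2 * a + d + 3 := by exact_mod_cast ha3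
    have h2 : (n : ℝ) * d ≤ f n := by exact_mod_cast hd1
    have h3 : (2 : ℝ) * a + 1 + d + 1 ≤ n := by exact_mod_cast ha2
    have h4 : (0 : ℝ) ≤ d := by positivity
    have h5 : (0 : ℝ) ≤ a := by positivity
    push_cast
    have key : (n : ℝ) ^ 2 / 4 - f n / 2 - n ≤ a * (a + 1) := by
      have h6 : ((n : ℝ) - d - 2) ^ 2 ≤ (2 * a + 1) ^ 2 :=
        pow_le_pow_left₀ (by linarith) (by linarith) 2
      nlinarith
    linarith
end
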